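/- Let R = ℤ[A, A^{−1}] be the ring of Laurent polynomials over ℤ, let δ = −A² − A^{−2} ∈ R, and let S = R[e]/(e² − δ·e) be the quotient of the polynomial ring R[e] by the ideal generated by e² − δe. Then for every natural number n, the following identity holds in S: δ · (A·1 + A^{−1}·e)^n = A^n · δ · 1 + ((−A^{−3})^n − A^n) · e. -/

import Mathlib

open LaurentPolynomial

/-- `δ = -A² - A^{-2}` in the ring of Laurent polynomials `ℤ[A^{±1}]`,
where `T n` denotes the monomial `A^n`. -/
noncomputable def deltaTL : LaurentPolynomial ℤ := -T 2 - T (-2)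

theorem twist_aux {S : Type*} [CommRing S] (a b d e : S) (hab : a * b = 1)
    (hd : d = -a ^ 2 - b ^ 2) (n : ℕ) :
    e ^ 2 - d * e ∣ d * (a + b * e) ^ n - (a ^ n * d + ((-b ^ 3) ^ n - a ^ n) * e) := by
  have h1 : b * d = -a - b ^ 3 := by rw [hd]; linear_combination (-a) * hab
  induction n with
  | zero => simp
  | succ k ih =>
    obtain ⟨c, hc⟩ := ih
    refine ⟨c * (a + b * e) + ((-b ^ 3) ^ k - a ^ k) * b, ?_⟩
    rw [pow_succ, pow_succ (-b ^ 3), pow_succ a]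
    linear_combination (a + b * e) * hc + (-b ^ 3) ^ k * e * h1

/-- **Key computation in Proposition 2.2 (paper).** In
`S = ℤ[A^{±1}][e]/(e² - δe)` (isomorphic to the Temperley–Lieb algebra `TL₂`),
with `ρ(σ₁) = A·1 + A^{-1}·e`, one has
`δ · (A·1 + A^{-1}·e)^n = A^n δ · 1 + ((-A^{-3})^n - A^n) · e`. -/
theorem twist_formula_TL2 (n : ℕ) :
    (Ideal.Quotient.mk
        (Ideal.span {(Polynomial.X : Polynomial (LaurentPolynomial ℤ)) ^ 2
          - Polynomial.C deltaTL * Polynomial.X}))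
      (Polynomial.C deltaTL
        * (Polynomial.C (T 1) + Polynomial.C (T (-1)) * Polynomial.X) ^ n)
    = (Ideal.Quotient.mk
        (Ideal.span {(Polynomial.X : Polynomial (LaurentPolynomial ℤ)) ^ 2
          - Polynomial.C deltaTL * Polynomial.X}))
      (Polynomial.C (T (n : ℤ) * deltaTL)
        + Polynomial.C ((-T (-3)) ^ n - T (n : ℤ)) * Polynomial.X) := by
  have hT3 : (T (-3) : LaurentPolynomial ℤ) = T (-1) ^ 3 := by
    rw [T_pow]; norm_num
  have hTn : (T (n : ℤ) : LaurentPolynomial ℤ) = T 1 ^ n := by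
    rw [T_pow]; simp
  rw [hT3, hTn]
  rw [Ideal.Quotient.eq, Ideal.mem_span_singleton]
  simp only [map_mul, map_sub, map_pow, map_neg]
  apply twist_aux
  · rw [← map_mul, ← T_add]; simp
  · rw [← map_pow, ← map_pow, ← map_neg, ← map_sub, T_pow, T_pow, deltaTL]
    norm_num
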